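/- Let A be an n×n complex matrix and 1 ≤ k ≤ n. If μ ∈ ℂ satisfies e^{iξ}μ + e^{-iξ}μ̄ ≤ λ_k(e^{iξ}A + e^{-iξ}A*) for every ξ ∈ [0, 2π), then μ ∈ Λ_k(A); that is, Ω_k(A) ⊆ Λ_k(A). -/

import Mathlib

open Matrix

/-- The `k`-th largest eigenvalue (counted with multiplicity) of a Hermitian matrix `H`;
junk value `0` if `H` is not Hermitian. -/
noncomputable def lambdaKth {n : ℕ} (H : Matrix (Fin n) (Fin n) ℂ) (k : ℕ) : ℝ :=
  if hH : H.IsHermitian then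
    ((Finset.univ.val.map hH.eigenvalues).sort (· ≤ ·)).getD (n - k) 0
  else 0

/-- The rank-`k` numerical range of a matrix `A`:
`{λ : PAP = λP` for some rank-`k` orthogonal projection `P}`. -/
def rankKRange {n : ℕ} (k : ℕ) (A : Matrix (Fin n) (Fin n) ℂ) : Set ℂ :=
  {μ | ∃ P : Matrix (Fin n) (Fin n) ℂ,
    P.IsHermitian ∧ P * P = P ∧ P.rank = k ∧ P * A * P = μ • P}

open Filter

lemma exists_alternating (s : ℝ → ℝ) (hs : ∀ e, s e = 1 ∨ s e = -1) (E : Finset ℝ) :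
    ∃ Y ⊆ E, (∀ e ∈ Y, s e = -(-1) ^ (Y.filter (e < ·)).card) ∧
      ∀ t, ∀ e ∈ E, t < e → (∀ e' ∈ E, t < e' → e ≤ e') →
        s e = (-1) ^ (Y.filter (t < ·)).card := by
  classical
  induction E using Finset.induction_on_min with
  | empty => exact ⟨∅, by simp⟩
  | insert a E ha ih =>
    obtain ⟨Y, hYE, hY1, hY2⟩ := ih
    have haY : a ∉ Y := fun h => lt_irrefl _ (ha a (hYE h))
    have hfY : ∀ t, t < a → Y.filter (t < ·) = Y := fun t ht =>
      Finset.filter_true_of_mem fun l hl => ht.trans (ha l (hYE hl))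
    have hfa : Y.filter (a < ·) = Y :=
      Finset.filter_true_of_mem fun l hl => ha l (hYE hl)
    have hins : ∀ t, a ≤ t → (insert a Y).filter (t < ·) = Y.filter (t < ·) := fun t ht => by
      rw [Finset.filter_insert, if_neg (not_lt.2 ht)]
    have hbelow : ∀ t e, e ∈ insert a E → t < e → (∀ e' ∈ insert a E, t < e' → e ≤ e') →
        (t < a ∧ e = a) ∨ (a ≤ t ∧ e ∈ E ∧ ∀ e' ∈ E, t < e' → e ≤ e') := by
      intro t e he hte hmin
      rcases lt_or_ge t a with hta | hta
      · left
        refine ⟨hta, ?_⟩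
        rcases Finset.mem_insert.1 he with h | h
        · exact h
        · exact absurd (ha e h) (not_lt.2 (hmin a (Finset.mem_insert_self _ _) hta))
      · right
        refine ⟨hta, ?_, fun e' he' => hmin e' (Finset.mem_insert_of_mem he')⟩
        rcases Finset.mem_insert.1 he with h | h
        · exact absurd (h ▸ hte) (not_lt.2 hta)
        · exact h
    by_cases hsa : s a = -(-1) ^ Y.card
    · refine ⟨insert a Y, Finset.insert_subset_insert _ hYE, ?_, ?_⟩
      · intro e he
        rcases Finset.mem_insert.1 he with rfl | he
        · rw [hins _ le_rfl, hfa, hsa]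
        · rw [hins _ (ha e (hYE he)).le, hY1 e he]
      · intro t e he hte hmin
        rcases hbelow t e he hte hmin with ⟨hta, rfl⟩ | ⟨hta, he, hmin⟩
        · rw [Finset.filter_insert, if_pos hta, hfY t hta, Finset.card_insert_of_notMem haY, hsa,
            pow_succ]
          ring
        · rw [hins t hta, hY2 t e he hte hmin]
    · have hsa' : s a = (-1) ^ Y.card := by
        rcases hs a with h | h <;> rcases neg_one_pow_eq_or ℝ Y.card with h' | h' <;>
          rw [h, h'] at hsa <;> rw [h, h'] <;> norm_num at hsa
      refine ⟨Y, hYE.trans (Finset.subset_insert _ _), hY1, ?_⟩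
      intro t e he hte hmin
      rcases hbelow t e he hte hmin with ⟨hta, rfl⟩ | ⟨hta, he, hmin⟩
      · rw [hfY t hta, hsa']
      · exact hY2 t e he hte hmin

lemma prod_sub_eq (Y : Finset ℝ) (t : ℝ) :
    ∏ l ∈ Y, (t - l) = (-1) ^ (Y.filter (t < ·)).card * ∏ l ∈ Y, |t - l| := by
  rw [← Finset.prod_const, Finset.prod_filter, ← Finset.prod_mul_distrib]
  refine Finset.prod_congr rfl fun l _ => ?_
  split_ifs with h
  · rw [abs_of_neg (sub_neg.2 h)]; ring
  · rw [abs_of_nonneg (sub_nonneg.2 (not_lt.1 h)), one_mul]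

lemma sum_nodalWeight_div (Y : Finset ℝ) (hY : Y.Nonempty) (t : ℝ) (ht : t ∉ Y) :
    ∑ e ∈ Y, Lagrange.nodalWeight Y id e * (t - e)⁻¹ = (∏ l ∈ Y, (t - l))⁻¹ := by
  have h := Lagrange.eval_interpolate_not_at_node (s := Y) (v := id) (x := t) (fun _ => (1 : ℝ))
    (fun i hi h => ht (by rw [h]; exact hi))
  have h1 : Lagrange.interpolate Y id (fun _ => (1 : ℝ)) = 1 :=
    Lagrange.interpolate_one (fun _ _ _ _ h => h) hY
  rw [h1, Lagrange.eval_nodal] at h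
  simp only [Polynomial.eval_one, mul_one, id] at h
  exact (eq_inv_of_mul_eq_one_right h.symm)

lemma crossing_bound {ι : Type*} [Fintype ι] (r x : ι → ℝ)
    (hsign : ∀ i j, x i = x j → 0 < r i * r j) (k : ℕ)
    (hP : ∀ᶠ t in cofinite, k ≤ (Finset.univ.filter fun i => 0 < r i * (t - x i)).card ∧
      (Finset.univ.filter fun i => 0 < r i * (t - x i)).card + k ≤ Fintype.card ι)
    (t : ℝ) (ht : ∀ i, t ≠ x i) (i₀ : ι) (hi₀ : t < x i₀) (hmin : ∀ j, t < x j → x i₀ ≤ x j) :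
    (r i₀ < 0 → k < (Finset.univ.filter fun i => 0 < r i * (t - x i)).card) ∧
    (0 < r i₀ →
      (Finset.univ.filter fun i => 0 < r i * (t - x i)).card + k < Fintype.card ι) := by
  have h1 : ∀ᶠ u in nhdsWithin (x i₀) (Set.Ioi (x i₀)), ∀ i, x i ≤ x i₀ ∨ u < x i := by
    rw [eventually_all]
    intro i
    rcases le_or_gt (x i) (x i₀) with h | h
    · exact Eventually.of_forall fun _ => Or.inl h
    · exact ((eventually_lt_nhds h).filter_mono nhdsWithin_le_nhds).mono fun _ => Or.inr
  have h2 := hP.filter_mono ((nhdsWithin_mono (x i₀) fun y (hy : x i₀ < y) => hy.ne').trans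
    (nhdsNE_le_cofinite (x i₀)))
  obtain ⟨u, ⟨hu1, hu2, hu3⟩, hu4⟩ := ((h1.and h2).and self_mem_nhdsWithin).exists
  have hu4 : x i₀ < u := hu4
  have hlt : ∀ i, x i < x i₀ → x i < t := fun i hi =>
    lt_of_le_of_ne (not_lt.1 fun h => absurd (hmin i h) (not_le.2 hi)) (ht i).symm
  have key : ∀ i, x i = x i₀ ∨ (0 < r i * (t - x i) ↔ 0 < r i * (u - x i)) := by
    intro i
    rcases hu1 i with h | h
    · rcases h.eq_or_lt with h | h
      · exact Or.inl h
      · right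
        rw [mul_pos_iff_of_pos_right (sub_pos.2 (hlt i h)),
          mul_pos_iff_of_pos_right (sub_pos.2 (h.trans hu4))]
    · right
      have h' : t - x i < 0 := by linarith
      have h'' : u - x i < 0 := by linarith
      rw [← neg_mul_neg, ← neg_mul_neg (r i) (u - x i),
        mul_pos_iff_of_pos_right (neg_pos.2 h'), mul_pos_iff_of_pos_right (neg_pos.2 h'')]
  constructor
  · intro hr
    refine lt_of_le_of_lt hu2 (Finset.card_lt_card ?_)
    rw [Finset.ssubset_iff_of_subset]
    · refine ⟨i₀, ?_, ?_⟩
      · simpa using mul_pos_of_neg_of_neg hr (sub_neg.2 hi₀)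
      · simpa using mul_nonpos_of_nonpos_of_nonneg hr.le (sub_nonneg.2 hu4.le)
    · intro i
      simp only [Finset.mem_filter, Finset.mem_univ, true_and]
      intro hi
      rcases key i with h | h
      · have hri : r i < 0 := by nlinarith [hsign i i₀ h]
        nlinarith
      · exact h.2 hi
  · intro hr
    refine lt_of_lt_of_le (Nat.add_lt_add_right (Finset.card_lt_card ?_) k) hu3
    rw [Finset.ssubset_iff_of_subset]
    · refine ⟨i₀, ?_, ?_⟩
      · simpa using mul_pos hr (sub_pos.2 hu4)
      · simpa using mul_nonpos_of_nonneg_of_nonpos hr.le (sub_nonpos.2 hi₀.le)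
    · intro i
      simp only [Finset.mem_filter, Finset.mem_univ, true_and]
      intro hi
      rcases key i with h | h
      · have hri : 0 < r i := by nlinarith [hsign i i₀ h]
        nlinarith
      · exact h.1 hi

lemma exists_weights {ι : Type*} [Fintype ι] [Nonempty ι] (r x : ι → ℝ) (hr : ∀ i, r i ≠ 0)
    (hsign : ∀ i j, x i = x j → 0 < r i * r j) (k : ℕ)
    (hk : (Finset.univ.filter fun i => 0 < r i).card = k)
    (hP : ∀ᶠ t in cofinite, k ≤ (Finset.univ.filter fun i => 0 < r i * (t - x i)).card ∧
      (Finset.univ.filter fun i => 0 < r i * (t - x i)).card + k ≤ Fintype.card ι) :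
    ∃ c : ι → ℝ, (∀ i, 0 ≤ c i) ∧ (∃ i, c i ≠ 0) ∧ ∀ t, (∀ i, t ≠ x i) →
      ((Finset.univ.filter fun i => 0 < r i * (t - x i)).card = k →
        ∑ i, c i / (r i * (t - x i)) ≤ 0) ∧
      ((Finset.univ.filter fun i => 0 < r i * (t - x i)).card + k = Fintype.card ι →
        0 ≤ ∑ i, c i / (r i * (t - x i))) := by
  classical
  let E : Finset ℝ := Finset.univ.image x
  have hxE : ∀ i, x i ∈ E := fun i => Finset.mem_image_of_mem x (Finset.mem_univ i)
  let s : ℝ → ℝ := fun e => if ∃ i, x i = e ∧ r i < 0 then -1 else 1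
  have hs : ∀ e, s e = 1 ∨ s e = -1 := fun e => by
    simp only [s]; split_ifs <;> simp
  have hsneg : ∀ i, r i < 0 → s (x i) = -1 := fun i hi => if_pos ⟨i, rfl, hi⟩
  have hspos : ∀ i, 0 < r i → s (x i) = 1 := fun i hi => if_neg (by
    rintro ⟨j, hj, hj'⟩
    nlinarith [hsign j i hj])
  have hsr : ∀ i, s (x i) * |r i| = r i := fun i => by
    rcases (hr i).lt_or_gt with h | h
    · rw [hsneg i h, abs_of_neg h]; ring
    · rw [hspos i h, abs_of_pos h]; ring
  obtain ⟨Y, hYE, hY1, hY2⟩ := exists_alternating s hs E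
  have hnext : ∀ t, (∃ i, t < x i) → ∃ i, t < x i ∧ ∀ j, t < x j → x i ≤ x j := by
    rintro t ⟨i, hi⟩
    obtain ⟨i₀, h1, h2⟩ := Finset.exists_min_image (Finset.univ.filter fun i => t < x i) x
      ⟨i, by simpa using hi⟩
    exact ⟨i₀, by simpa using h1, fun j hj => h2 j (by simpa using hj)⟩
  have hcross : ∀ t, (∀ i, t ≠ x i) → (∃ i, t < x i) →
      (((-1 : ℝ) ^ (Y.filter (t < ·)).card = 1 ∧
        (Finset.univ.filter fun i => 0 < r i * (t - x i)).card + k < Fintype.card ι) ∨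
      ((-1 : ℝ) ^ (Y.filter (t < ·)).card = -1 ∧
        k < (Finset.univ.filter fun i => 0 < r i * (t - x i)).card)) := by
    intro t ht hex
    obtain ⟨i, hi, hmin⟩ := hnext t hex
    have h := crossing_bound r x hsign k hP t ht i hi hmin
    have h2 := hY2 t (x i) (hxE i) hi (by
      intro e he hte
      obtain ⟨j, -, rfl⟩ := Finset.mem_image.1 he
      exact hmin j hte)
    rcases (hr i).lt_or_gt with h' | h'
    · exact Or.inr ⟨h2 ▸ hsneg i h', h.1 h'⟩
    · exact Or.inl ⟨h2 ▸ hspos i h', h.2 h'⟩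
  obtain ⟨t₀, ht₀⟩ : ∃ t₀, ∀ i, t₀ < x i := by
    obtain ⟨i, hi⟩ := Finite.exists_min x
    exact ⟨x i - 1, fun j => by linarith [hi j]⟩
  have hPt₀ : (Finset.univ.filter fun i => 0 < r i * (t₀ - x i)).card + k = Fintype.card ι := by
    have : (Finset.univ.filter fun i => 0 < r i * (t₀ - x i)) =
        Finset.univ.filter fun i => ¬ 0 < r i := by
      refine Finset.filter_congr fun i _ => ?_
      rw [not_lt, ← neg_mul_neg, mul_pos_iff_of_pos_right (neg_pos.2 (sub_neg.2 (ht₀ i))), neg_pos]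
      exact ⟨le_of_lt, fun h => lt_of_le_of_ne h (hr i)⟩
    rw [this, ← hk, add_comm, Finset.card_filter_add_card_filter_not, Finset.card_univ]
  have hc₀ := hcross t₀ (fun i => (ht₀ i).ne) ⟨Classical.arbitrary ι, ht₀ _⟩
  have hlt : 2 * k < Fintype.card ι := by omega
  have hYne : Y.Nonempty := by
    rw [Finset.nonempty_iff_ne_empty]
    rintro rfl
    simp at hc₀
    rcases hc₀ with h | ⟨h, -⟩
    · omega
    · norm_num at h
  have hρ : ∀ e, e ∈ Y → ∃ i, x i = e := fun e he => by
    simpa [E] using hYE he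
  choose! ρ hρ using hρ
  have hw : ∀ e ∈ Y, Lagrange.nodalWeight Y id e = -(s e) * |Lagrange.nodalWeight Y id e| := by
    intro e he
    have : Lagrange.nodalWeight Y id e = (∏ l ∈ Y.erase e, (e - l))⁻¹ := by
      simp [Lagrange.nodalWeight, Finset.prod_inv_distrib]
    have hf : (Y.erase e).filter (e < ·) = Y.filter (e < ·) := by
      ext l
      simp only [Finset.mem_filter, Finset.mem_erase]
      exact ⟨fun h => ⟨h.1.2, h.2⟩, fun h => ⟨⟨h.2.ne', h.1⟩, h.2⟩⟩
    rw [this, abs_inv, prod_sub_eq, hf, hY1 e he, neg_neg, abs_mul, abs_pow, abs_neg, abs_one,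
      one_pow, one_mul, mul_inv, Finset.abs_prod]
    simp only [abs_abs]
    rcases neg_one_pow_eq_or ℝ (Y.filter (e < ·)).card with h | h <;> rw [h] <;> norm_num
  have hwne : ∀ e ∈ Y, Lagrange.nodalWeight Y id e ≠ 0 := fun e he =>
    Lagrange.nodalWeight_ne_zero (fun _ _ _ _ h => h) he
  have hρinj : Set.InjOn ρ Y := fun a ha b hb h => by rw [← hρ a ha, ← hρ b hb, h]
  let c : ι → ℝ := fun i => if i ∈ Y.image ρ then |r i| * |Lagrange.nodalWeight Y id (x i)| else 0
  have hsum : ∀ t, t ∉ Y → ∑ i, c i / (r i * (t - x i)) = -(∏ l ∈ Y, (t - l))⁻¹ := by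
    intro t ht
    rw [← sum_nodalWeight_div Y hYne t ht, ← Finset.sum_neg_distrib]
    have : ∀ i, c i / (r i * (t - x i)) = if i ∈ Y.image ρ then
        |r i| * |Lagrange.nodalWeight Y id (x i)| / (r i * (t - x i)) else 0 := fun i => by
      simp only [c]; split_ifs <;> simp
    rw [Finset.sum_congr rfl fun i _ => this i, Finset.sum_ite_mem, Finset.univ_inter,
      Finset.sum_image hρinj]
    refine Finset.sum_congr rfl fun e he => ?_
    have h1 := hsr (ρ e)
    have h2 := hw e he
    rw [hρ e he] at h1 ⊢
    have h3 : |r (ρ e)| ≠ 0 := abs_ne_zero.2 (hr _)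
    have h4 : t - e ≠ 0 := sub_ne_zero.2 fun h => ht (h ▸ he)
    rw [h2, ← h1]
    simp only [abs_mul, abs_neg, abs_abs]
    rcases hs e with h | h <;> rw [h] <;> norm_num <;> field_simp
  refine ⟨c, fun i => ?_, ?_, fun t ht => ?_⟩
  · simp only [c]; split_ifs <;> positivity
  · obtain ⟨e, he⟩ := hYne
    refine ⟨ρ e, ?_⟩
    simp only [c]
    rw [if_pos (Finset.mem_image_of_mem ρ he), hρ e he]
    exact mul_ne_zero (abs_ne_zero.2 (hr _)) (abs_ne_zero.2 (hwne e he))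
  · have htY : t ∉ Y := fun h => ht _ (hρ t h).symm
    have hpos : 0 ≤ (∏ l ∈ Y, |t - l|)⁻¹ := inv_nonneg.2 (Finset.prod_nonneg fun _ _ => abs_nonneg _)
    rw [hsum t htY, prod_sub_eq, mul_inv]
    by_cases hex : ∃ i, t < x i
    · rcases hcross t ht hex with ⟨h1, h2⟩ | ⟨h1, h2⟩
      · rw [h1]
        exact ⟨fun _ => by simpa using hpos, fun h => by omega⟩
      · rw [h1]
        exact ⟨fun h => by omega, fun _ => by norm_num; simpa using hpos⟩
    · push Not at hex
      have h0 : Y.filter (t < ·) = ∅ := Finset.filter_false_of_mem fun e he => by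
        rw [← hρ e he]; exact not_lt.2 (hex _)
      have h1 : (Finset.univ.filter fun i => 0 < r i * (t - x i)) =
          Finset.univ.filter fun i => 0 < r i := Finset.filter_congr fun i _ =>
        mul_pos_iff_of_pos_right (sub_pos.2 (lt_of_le_of_ne (hex i) (ht i).symm))
      rw [h0, h1, hk]
      exact ⟨fun _ => by simpa using hpos, fun h => by omega⟩

lemma finrank_le_card_pos {ι : Type*} [Fintype ι] (R : ι → ℝ) (hR : ∀ i, R i ≠ 0)
    (N : Submodule ℂ (ι → ℂ)) (hN : ∀ w ∈ N, 0 ≤ ∑ i, R i * ‖w i‖ ^ 2) :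
    Module.finrank ℂ N ≤ (Finset.univ.filter fun i => 0 < R i).card := by
  let f : N →ₗ[ℂ] ({i // 0 < R i} → ℂ) :=
    (LinearMap.funLeft ℂ ℂ (Subtype.val : {i // 0 < R i} → ι)).comp N.subtype
  have hf : Function.Injective f := by
    rw [← LinearMap.ker_eq_bot, LinearMap.ker_eq_bot']
    rintro ⟨w, hw⟩ h
    have h0 : ∀ i, 0 < R i → w i = 0 := fun i hi => congrFun h ⟨i, hi⟩
    have hle : ∀ i, R i * ‖w i‖ ^ 2 ≤ 0 := fun i => by
      rcases (hR i).lt_or_gt with h | h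
      · exact mul_nonpos_of_nonpos_of_nonneg h.le (by positivity)
      · simp [h0 i h]
    have h1 : ∑ i, R i * ‖w i‖ ^ 2 = 0 :=
      le_antisymm (Finset.sum_nonpos fun i _ => hle i) (hN w hw)
    rw [Finset.sum_eq_zero_iff_of_nonpos fun i _ => hle i] at h1
    ext i
    simpa [hR i] using h1 i (Finset.mem_univ i)
  have := LinearMap.finrank_le_finrank_of_injective hf
  rwa [Module.finrank_pi, Fintype.card_subtype] at this

lemma exists_nonneg_of_lt_card_pos {ι : Type*} [Fintype ι] (R y : ι → ℝ) (k : ℕ)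
    (hk : k < (Finset.univ.filter fun i => 0 < R i).card) :
    ∃ N : Submodule ℂ (ι → ℂ), k ≤ Module.finrank ℂ N ∧
      ∀ w ∈ N, ∑ i, (y i : ℂ) * w i = 0 ∧ 0 ≤ ∑ i, R i * ‖w i‖ ^ 2 := by
  classical
  let Φ : ({i // 0 < R i} → ℂ) →ₗ[ℂ] (ι → ℂ) :=
    LinearMap.pi fun i => if h : 0 < R i then LinearMap.proj ⟨i, h⟩ else 0
  have hΦ : Function.Injective Φ := fun w w' h => by
    ext ⟨i, hi⟩
    have := congrFun h i
    simpa [Φ, hi] using this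
  let l : (ι → ℂ) →ₗ[ℂ] ℂ := ∑ i, (y i : ℂ) • LinearMap.proj i
  have hl : ∀ w, l w = ∑ i, (y i : ℂ) * w i := fun w => by simp [l]
  refine ⟨(LinearMap.ker (l ∘ₗ Φ)).map Φ, ?_, ?_⟩
  · rw [← (Submodule.equivMapOfInjective Φ hΦ _).finrank_eq]
    have h1 := LinearMap.finrank_range_add_finrank_ker (l ∘ₗ Φ)
    have h2 := Submodule.finrank_le (LinearMap.range (l ∘ₗ Φ))
    rw [Module.finrank_pi, Fintype.card_subtype] at h1
    rw [Module.finrank_self] at h2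
    omega
  · rintro _ ⟨w, hw, rfl⟩
    refine ⟨by rw [← hl]; exact hw, Finset.sum_nonneg fun i _ => ?_⟩
    by_cases h : 0 < R i
    · positivity
    · simp [Φ, h]

lemma exists_nonneg_of_sum_nonpos {ι : Type*} [Fintype ι] (R y : ι → ℝ) (hR : ∀ i, R i ≠ 0)
    (hy : ∃ i, y i ≠ 0) (hs : ∑ i, y i ^ 2 / R i ≤ 0) :
    ∃ N : Submodule ℂ (ι → ℂ), (Finset.univ.filter fun i => 0 < R i).card ≤ Module.finrank ℂ N ∧
      ∀ w ∈ N, ∑ i, (y i : ℂ) * w i = 0 ∧ 0 ≤ ∑ i, R i * ‖w i‖ ^ 2 := by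
  classical
  let F₁ : ℝ := ∑ i : {i // 0 < R i}, y i ^ 2 / R i
  let F₂ : ℝ := ∑ i : {i // ¬ 0 < R i}, y i ^ 2 / R i
  have hF : F₁ + F₂ ≤ 0 := by
    rw [Fintype.sum_subtype_add_sum_subtype (fun i => 0 < R i) fun i => y i ^ 2 / R i]
    exact hs
  have hF₁ : 0 ≤ F₁ := Finset.sum_nonneg fun i _ => div_nonneg (sq_nonneg _) i.2.le
  have hF₂ : F₂ < 0 := by
    refine lt_of_le_of_ne (by linarith) fun h0 => ?_
    have h1 : F₁ = 0 := by linarith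
    rw [Finset.sum_eq_zero_iff_of_nonneg fun i _ => div_nonneg (sq_nonneg _) i.2.le] at h1
    rw [Finset.sum_eq_zero_iff_of_nonpos fun i _ =>
      div_nonpos_of_nonneg_of_nonpos (sq_nonneg _) (not_lt.1 i.2)] at h0
    obtain ⟨i, hi⟩ := hy
    by_cases h : 0 < R i
    · have := h1 ⟨i, h⟩ (Finset.mem_univ _)
      simp [hi, hR] at this
    · have := h0 ⟨i, h⟩ (Finset.mem_univ _)
      simp [hi, hR] at this
  let l : ({i // 0 < R i} → ℂ) →ₗ[ℂ] ℂ := ∑ i : {i // 0 < R i}, (y i : ℂ) • LinearMap.proj i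
  have hl : ∀ w, l w = ∑ i : {i // 0 < R i}, (y i : ℂ) * w i := fun w => by simp [l]
  let Φ : ({i // 0 < R i} → ℂ) →ₗ[ℂ] (ι → ℂ) :=
    LinearMap.pi fun i => if h : 0 < R i then LinearMap.proj ⟨i, h⟩
      else ((-(y i / (R i * F₂)) : ℝ) : ℂ) • l
  have hΦ₁ : ∀ w (i : {i // 0 < R i}), Φ w i = w i := fun w i => by simp [Φ, i.2]
  have hΦ₂ : ∀ w (i : {i // ¬ 0 < R i}), Φ w i = ((-(y i / (R i * F₂)) : ℝ) : ℂ) * l w :=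
    fun w i => by simp only [Φ, LinearMap.pi_apply, i.2, dif_neg, not_false_eq_true]; rfl
  have hΦ : Function.Injective Φ := fun w w' h => by
    ext i
    have := congrFun h i
    rwa [hΦ₁, hΦ₁] at this
  refine ⟨LinearMap.range Φ, ?_, ?_⟩
  · rw [LinearMap.finrank_range_of_inj hΦ, Module.finrank_pi, Fintype.card_subtype]
  · rintro _ ⟨w, rfl⟩
    constructor
    · rw [← Fintype.sum_subtype_add_sum_subtype (fun i => 0 < R i)]
      simp only [hΦ₁, hΦ₂]
      rw [← hl]
      have : ∑ i : {i // ¬ 0 < R i}, (y i : ℂ) * (((-(y i / (R i * F₂)) : ℝ) : ℂ) * l w) =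
          ((∑ i : {i // ¬ 0 < R i}, -(y i ^ 2 / R i) / F₂ : ℝ) : ℂ) * l w := by
        rw [Complex.ofReal_sum, Finset.sum_mul]
        refine Finset.sum_congr rfl fun i _ => ?_
        rw [← mul_assoc, ← Complex.ofReal_mul]
        congr 2
        have := hR i
        field_simp
      rw [this, ← Finset.sum_div, Finset.sum_neg_distrib, neg_div]
      change _ + ((-(F₂ / F₂) : ℝ) : ℂ) * _ = 0
      rw [div_self hF₂.ne]
      simp
    · rw [← Fintype.sum_subtype_add_sum_subtype (fun i => 0 < R i)]
      simp only [hΦ₁, hΦ₂]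
      have h2 : ∑ i : {i // ¬ 0 < R i}, R i * ‖((-(y i / (R i * F₂)) : ℝ) : ℂ) * l w‖ ^ 2 =
          ‖l w‖ ^ 2 / F₂ := by
        have : ∀ i : {i // ¬ 0 < R i}, R i * ‖((-(y i / (R i * F₂)) : ℝ) : ℂ) * l w‖ ^ 2 =
            y i ^ 2 / R i * (‖l w‖ ^ 2 / F₂ ^ 2) := fun i => by
          rw [norm_mul, Complex.norm_real, mul_pow, Real.norm_eq_abs, sq_abs]
          have := hR i
          field_simp
        rw [Finset.sum_congr rfl fun i _ => this i, ← Finset.sum_mul]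
        change F₂ * _ = _
        field_simp
      rw [h2]
      set G : ℝ := ∑ i : {i // 0 < R i}, R i * ‖w i‖ ^ 2
      have hG : 0 ≤ G := Finset.sum_nonneg fun i _ => mul_nonneg i.2.le (by positivity)
      have h3 : ‖l w‖ ^ 2 ≤ F₁ * G := by
        have h4 : ‖l w‖ ≤ ∑ i : {i // 0 < R i}, |y i| * ‖w i‖ := by
          rw [hl]
          refine (norm_sum_le _ _).trans_eq (Finset.sum_congr rfl fun i _ => ?_)
          rw [norm_mul, Complex.norm_real, Real.norm_eq_abs]
        refine (pow_le_pow_left₀ (norm_nonneg _) h4 2).trans ?_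
        refine Finset.sum_sq_le_sum_mul_sum_of_sq_le_mul _
          (fun i _ => div_nonneg (sq_nonneg _) i.2.le)
          (fun i _ => mul_nonneg i.2.le (by positivity)) fun i _ => le_of_eq ?_
        have := hR i
        rw [mul_pow, sq_abs]
        field_simp
      have h5 : F₁ * G ≤ -F₂ * G := mul_le_mul_of_nonneg_right (by linarith) hG
      have h6 : ‖l w‖ ^ 2 / F₂ ≥ -G := by
        rw [ge_iff_le, le_div_iff_of_neg hF₂]
        linarith
      linarith

lemma eventually_circle_ne (α β : ℂ) (h : α ≠ 0 ∨ β ≠ 0) :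
    ∀ᶠ z : Circle in cofinite, (z : ℂ) * β + (starRingEnd ℂ) z * α ≠ 0 := by
  rw [eventually_cofinite]
  have hfin : ((Polynomial.C β * Polynomial.X ^ 2 + Polynomial.C α).rootSet ℂ).Finite :=
    Polynomial.rootSet_finite _ _
  refine (hfin.preimage Circle.coe_injective.injOn).subset fun (z : Circle) hz => ?_
  replace hz : (z : ℂ) * β + (starRingEnd ℂ) z * α = 0 := not_not.1 hz
  have hne : Polynomial.C β * Polynomial.X ^ 2 + Polynomial.C α ≠ 0 := fun h0 => by
    have h1 := congrArg (fun p => Polynomial.coeff p 0) h0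
    have h2 := congrArg (fun p => Polynomial.coeff p 2) h0
    simp [Polynomial.coeff_X_pow, Polynomial.coeff_C] at h1 h2
    rcases h with h | h <;> contradiction
  have hz1 : (z : ℂ) * (starRingEnd ℂ) z = 1 := by
    rw [Complex.mul_conj, Circle.normSq_coe]; simp
  change (z : ℂ) ∈ (Polynomial.C β * Polynomial.X ^ 2 + Polynomial.C α).rootSet ℂ
  rw [Polynomial.mem_rootSet]
  refine ⟨hne, ?_⟩
  simp only [map_add, map_mul, map_pow, Polynomial.aeval_X, Polynomial.aeval_C,
    Algebra.algebraMap_self, RingHom.id_apply]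
  linear_combination (z : ℂ) * hz - α * hz1

/-- The point of the unit circle in direction `t - i`. -/
noncomputable def circleDir (t : ℝ) : Circle :=
  ⟨(t - Complex.I) / ‖(t - Complex.I : ℂ)‖, by
    have h : (t - Complex.I : ℂ) ≠ 0 := fun h => by simpa using congrArg Complex.im h
    refine mem_sphere_zero_iff_norm.2 ?_
    rw [norm_div, Complex.norm_real, norm_norm, div_self (norm_ne_zero_iff.2 h)]⟩

lemma coe_circleDir (t : ℝ) :
    (circleDir t : ℂ) = ((‖(t - Complex.I : ℂ)‖⁻¹ : ℝ) : ℂ) * (t - Complex.I) := by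
  rw [Complex.ofReal_inv, mul_comm, ← div_eq_mul_inv]; rfl

lemma norm_sub_I_pos (t : ℝ) : 0 < ‖(t - Complex.I : ℂ)‖⁻¹ := by
  have h : (t - Complex.I : ℂ) ≠ 0 := fun h => by simpa using congrArg Complex.im h
  positivity

lemma circleDir_injective : Function.Injective circleDir := fun t t' h => by
  have h' : (circleDir t : ℂ) = circleDir t' := by rw [h]
  rw [coe_circleDir, coe_circleDir] at h'
  have h1 := congrArg Complex.re h'
  have h2 := congrArg Complex.im h'
  rw [Complex.re_ofReal_mul, Complex.re_ofReal_mul] at h1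
  rw [Complex.im_ofReal_mul, Complex.im_ofReal_mul] at h2
  simp only [Complex.sub_re, Complex.ofReal_re, Complex.I_re, sub_zero, Complex.sub_im,
    Complex.ofReal_im, Complex.I_im, zero_sub, mul_neg, mul_one, neg_inj] at h1 h2
  rw [h2] at h1
  exact mul_left_cancel₀ (norm_sub_I_pos t').ne' h1

lemma re_mul_sub_I {d : ℂ} {u : ℂ} (h : (u * d).re ≠ 0) (t : ℝ) :
    (u * (t - Complex.I) * d).re = (u * d).re * (t - -((u * d).im / (u * d).re)) := by
  have : u * (t - Complex.I) * d = (u * d) * (t - Complex.I) := by ring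
  rw [this]
  generalize u * d = w at h
  rw [Complex.mul_re]
  simp
  field_simp

lemma exists_hyperplane_of_diagonal {ι : Type*} [Fintype ι] [Nonempty ι] (d : ι → ℂ)
    (hd : ∀ i, d i ≠ 0) (hpar : ∀ i j (ρ : ℝ), d i = ρ * d j → 0 < ρ) (k : ℕ)
    (hk : ∀ᶠ z : Circle in cofinite,
      k ≤ (Finset.univ.filter fun i => 0 < ((z : ℂ) * d i).re).card) :
    ∃ y : ι → ℝ, (∃ i, y i ≠ 0) ∧ ∀ᶠ z : Circle in cofinite,
      ∃ N : Submodule ℂ (ι → ℂ), k ≤ Module.finrank ℂ N ∧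
        ∀ w ∈ N, ∑ i, (y i : ℂ) * w i = 0 ∧ 0 ≤ ∑ i, ((z : ℂ) * d i).re * ‖w i‖ ^ 2 := by
  classical
  have hne : ∀ᶠ z : Circle in cofinite, ∀ i, ((z : ℂ) * d i).re ≠ 0 := by
    rw [eventually_all]
    intro i
    filter_upwards [eventually_circle_ne ((starRingEnd ℂ) (d i)) (d i) (Or.inr (hd i))] with z hz h
    apply hz
    rw [← map_mul, Complex.add_conj, h]
    simp
  by_cases hlt : ∀ᶠ z : Circle in cofinite,
      k < (Finset.univ.filter fun i => 0 < ((z : ℂ) * d i).re).card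
  · exact ⟨fun _ => 1, ⟨Classical.arbitrary ι, one_ne_zero⟩,
      hlt.mono fun z hz => exists_nonneg_of_lt_card_pos _ _ _ hz⟩
  obtain ⟨u, hu1, hu2, hu3⟩ := ((not_eventually.1 hlt).and_eventually (hk.and hne)).exists
  set r : ι → ℝ := fun i => ((u : ℂ) * d i).re with hr
  set x : ι → ℝ := fun i => -(((u : ℂ) * d i).im / ((u : ℂ) * d i).re) with hx
  have hu0 : (u : ℂ) ≠ 0 := u.coe_ne_zero
  have hsign : ∀ i j, x i = x j → 0 < r i * r j := by
    intro i j hij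
    have h1 : d i = ((r i / r j : ℝ) : ℂ) * d j := by
      apply mul_left_cancel₀ hu0
      have hij' : ((u : ℂ) * d i).im * r j = ((u : ℂ) * d j).im * r i := by
        have h := neg_inj.1 hij
        rwa [div_eq_div_iff (hu3 i) (hu3 j)] at h
      have : (u : ℂ) * (((r i / r j : ℝ) : ℂ) * d j) = ((r i / r j : ℝ) : ℂ) * (u * d j) := by ring
      rw [this]
      apply Complex.ext
      · rw [Complex.re_ofReal_mul, div_mul_cancel₀ _ (hu3 j)]
      · rw [Complex.im_ofReal_mul, div_mul_eq_mul_div, eq_div_iff (hu3 j), hij']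
        ring
    have h2 := hpar i j _ h1
    have h3 : 0 < r j ^ 2 := by have := hu3 j; positivity
    have : r i * r j = r i / r j * r j ^ 2 := by
      have := hu3 j
      field_simp
    rw [this]; positivity
  have hform : ∀ (t : ℝ) i, ((u : ℂ) * (t - Complex.I) * d i).re = r i * (t - x i) :=
    fun t i => re_mul_sub_I (hu3 i) t
  have hneg : ∀ R : ι → ℝ, (∀ i, R i ≠ 0) → (Finset.univ.filter fun i => 0 < R i).card +
      (Finset.univ.filter fun i => 0 < - R i).card = Fintype.card ι := by
    intro R hR
    have : (Finset.univ.filter fun i => 0 < - R i) = Finset.univ.filter fun i => ¬ 0 < R i :=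
      Finset.filter_congr fun i _ => by
        rw [neg_pos, not_lt]; exact ⟨le_of_lt, fun h => lt_of_le_of_ne h (hR i)⟩
    rw [this, Finset.card_filter_add_card_filter_not, Finset.card_univ]
  have hscale : ∀ (c : ℝ) (R : ι → ℝ), 0 < c →
      (Finset.univ.filter fun i => 0 < c * R i) = Finset.univ.filter fun i => 0 < R i :=
    fun c R hc => Finset.filter_congr fun i _ => mul_pos_iff_of_pos_left hc
  have hP : ∀ᶠ t : ℝ in cofinite,
      k ≤ (Finset.univ.filter fun i => 0 < r i * (t - x i)).card ∧
      (Finset.univ.filter fun i => 0 < r i * (t - x i)).card + k ≤ Fintype.card ι := by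
    have hi1 : Function.Injective fun t => u * circleDir t := fun t t' h =>
      circleDir_injective (mul_left_cancel h)
    have hi2 : Function.Injective fun t => -(u * circleDir t) := fun t t' h =>
      hi1 (neg_injective h)
    filter_upwards [hi1.tendsto_cofinite.eventually hk, hi2.tendsto_cofinite.eventually hk,
      hi1.tendsto_cofinite.eventually hne] with t h1 h2 h3
    have he : ∀ i, (((u * circleDir t : Circle) : ℂ) * d i).re =
        ‖(t - Complex.I : ℂ)‖⁻¹ * (r i * (t - x i)) := fun i => by
      rw [← hform, ← Complex.re_ofReal_mul, Circle.coe_mul, coe_circleDir]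
      congr 1; ring
    have he' : ∀ i, (((-(u * circleDir t) : Circle) : ℂ) * d i).re =
        ‖(t - Complex.I : ℂ)‖⁻¹ * -(r i * (t - x i)) := fun i => by
      have hcn : ((-(u * circleDir t) : Circle) : ℂ) = -((u * circleDir t : Circle) : ℂ) := rfl
      rw [hcn, neg_mul, Complex.neg_re, he, mul_neg]
    simp only [he, he'] at h1 h2 h3
    rw [hscale _ _ (norm_sub_I_pos t)] at h1 h2
    have h4 := hneg _ fun i => right_ne_zero_of_mul (h3 i)
    exact ⟨h1, by omega⟩
  obtain ⟨c, hc0, ⟨i₀, hi₀⟩, hc⟩ := exists_weights r x hu3 hsign k (le_antisymm (not_lt.1 hu1) hu2) hP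
  refine ⟨fun i => √(c i), ⟨i₀, (Real.sqrt_ne_zero (hc0 i₀)).2 hi₀⟩, ?_⟩
  have him : ∀ᶠ z : Circle in cofinite, ((z : ℂ) / u).im ≠ 0 := by
    filter_upwards [eventually_circle_ne (-(starRingEnd ℂ) (u⁻¹ : ℂ)) (u⁻¹ : ℂ)
      (Or.inr (inv_ne_zero hu0))] with z hz h
    apply hz
    rw [mul_neg, ← map_mul, ← sub_eq_add_neg, Complex.sub_conj, ← div_eq_mul_inv, h]
    simp
  filter_upwards [hk, hne, him] with z hz1 hz2 hz3
  rcases hz1.lt_or_eq with hz1 | hz1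
  · exact exists_nonneg_of_lt_card_pos _ _ _ hz1
  set σ : ℝ := -((z : ℂ) / u).im with hσ
  set t : ℝ := -(((z : ℂ) / u).re / ((z : ℂ) / u).im) with ht
  have hσ0 : σ ≠ 0 := neg_ne_zero.2 hz3
  have hzt : (z : ℂ) = σ * (u * (t - Complex.I)) := by
    have : (z : ℂ) / u = σ * (t - Complex.I) := by
      apply Complex.ext
      · rw [Complex.re_ofReal_mul]; simp [σ, t]; field_simp
      · rw [Complex.im_ofReal_mul]; simp [σ]
    rw [div_eq_iff hu0] at this
    rw [this]; ring
  have hR : ∀ i, ((z : ℂ) * d i).re = σ * (r i * (t - x i)) := fun i => by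
    rw [← hform, ← Complex.re_ofReal_mul, hzt]
    congr 1; ring
  have htx : ∀ i, t ≠ x i := fun i h => hz2 i (by rw [hR, h]; simp)
  have hsum : ∑ i, √(c i) ^ 2 / ((z : ℂ) * d i).re = σ⁻¹ * ∑ i, c i / (r i * (t - x i)) := by
    rw [Finset.mul_sum]
    refine Finset.sum_congr rfl fun i _ => ?_
    rw [Real.sq_sqrt (hc0 i), hR, ← div_div, div_eq_mul_inv (c i), mul_comm (c i), mul_div_assoc]
  have hle : ∑ i, √(c i) ^ 2 / ((z : ℂ) * d i).re ≤ 0 := by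
    rw [hsum]
    simp only [hR] at hz1 hz2
    rcases hσ0.lt_or_gt with h | h
    · have h1 : ∀ i, σ * (r i * (t - x i)) = -σ * -(r i * (t - x i)) := fun i => by ring
      simp only [h1] at hz1
      rw [hscale _ _ (neg_pos.2 h)] at hz1
      have h4 := hneg _ fun i => right_ne_zero_of_mul (hz2 i)
      exact mul_nonpos_of_nonpos_of_nonneg (inv_nonpos.2 h.le) ((hc t htx).2 (by omega))
    · rw [hscale _ _ h] at hz1
      exact mul_nonpos_of_nonneg_of_nonpos (inv_nonneg.2 h.le) ((hc t htx).1 hz1.symm)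
  obtain ⟨N, hN1, hN2⟩ := exists_nonneg_of_sum_nonpos (fun i => ((z : ℂ) * d i).re)
    (fun i => √(c i)) hz2 ⟨i₀, (Real.sqrt_ne_zero (hc0 i₀)).2 hi₀⟩ hle
  exact ⟨N, hz1.le.trans hN1, hN2⟩

section Sesquilinear

variable {V : Type*} [AddCommGroup V] [Module ℂ V]

/-- `x` is an eigenvector, relative to `U`, of the pencil spanned by `a` and its adjoint. -/
def IsPencilVector (a : V →ₗ⋆[ℂ] V →ₗ[ℂ] ℂ) (U : Submodule ℂ V) (x : V) : Prop :=
  ∃ α β : ℂ, (α ≠ 0 ∨ β ≠ 0) ∧ ∀ y ∈ U, α * a y x = β * (starRingEnd ℂ) (a x y)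

/-- `U` has a subspace of dimension at least `k` on which `Re (u a)` is nonnegative. -/
def HasNonnegSubspace (a : V →ₗ⋆[ℂ] V →ₗ[ℂ] ℂ) (U : Submodule ℂ V) (k : ℕ) (u : ℂ) : Prop :=
  ∃ N ≤ U, k ≤ Module.finrank ℂ N ∧ ∀ w ∈ N, 0 ≤ (u * a w w).re

lemma sesq_sum (a : V →ₗ⋆[ℂ] V →ₗ[ℂ] ℂ) {ι : Type*} [Fintype ι] (v : ι → V) (w w' : ι → ℂ) :
    a (∑ i, w i • v i) (∑ j, w' j • v j) =
      ∑ i, ∑ j, (starRingEnd ℂ) (w i) * (w' j * a (v i) (v j)) := by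
  simp only [map_sum, map_smulₛₗ, LinearMap.sum_apply, LinearMap.smul_apply, smul_eq_mul,
    RingHom.id_apply]
  simp only [Finset.mul_sum]
  rw [Finset.sum_comm]
  exact Finset.sum_congr rfl fun _ _ => Finset.sum_congr rfl fun _ _ => by ring

variable [FiniteDimensional ℂ V]

lemma exists_pencilVector (a : V →ₗ⋆[ℂ] V →ₗ[ℂ] ℂ) (U : Submodule ℂ V) (hU : U ≠ ⊥) :
    ∃ x ∈ U, x ≠ 0 ∧ IsPencilVector a U x := by
  classical
  have : Nontrivial U := Submodule.nontrivial_iff_ne_bot.2 hU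
  let b := Module.finBasis ℂ U
  have : Nonempty (Fin (Module.finrank ℂ U)) := Fin.pos_iff_nonempty.1 Module.finrank_pos
  let M : Matrix (Fin (Module.finrank ℂ U)) (Fin (Module.finrank ℂ U)) ℂ :=
    Matrix.of fun i j => a (b i) (b j)
  obtain ⟨w, hw, α, β, hαβ, h⟩ : ∃ w : Fin (Module.finrank ℂ U) → ℂ, w ≠ 0 ∧ ∃ α β : ℂ,
      (α ≠ 0 ∨ β ≠ 0) ∧ α • (M *ᵥ w) = β • (Mᴴ *ᵥ w) := by
    by_cases hdet : M.det = 0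
    · obtain ⟨w, hw, h⟩ := Matrix.exists_mulVec_eq_zero_iff.2 hdet
      exact ⟨w, hw, 1, 0, Or.inl one_ne_zero, by simp [h]⟩
    · obtain ⟨c, hc⟩ := Module.End.exists_eigenvalue (Matrix.toLin' (M⁻¹ * Mᴴ))
      obtain ⟨w, hw⟩ := hc.exists_hasEigenvector
      refine ⟨w, hw.2, c, 1, Or.inr one_ne_zero, ?_⟩
      have h := hw.apply_eq_smul
      rw [Matrix.toLin'_apply] at h
      rw [← Matrix.mulVec_smul, ← h, Matrix.mulVec_mulVec, one_smul,
        Matrix.mul_nonsing_inv_cancel_left _ _ (isUnit_iff_ne_zero.2 hdet)]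
  refine ⟨∑ i, w i • (b i : V), Submodule.sum_mem _ fun i _ => U.smul_mem _ (b i).2, ?_, α, β,
    hαβ, ?_⟩
  · intro h0
    apply hw
    have h1 : ∑ i, w i • b i = 0 := by
      apply Subtype.ext
      simpa using h0
    exact funext fun i => Fintype.linearIndependent_iff.1 b.linearIndependent w h1 i
  · intro y hy
    have hy' : y = ∑ i, (b.repr ⟨y, hy⟩ i) • (b i : V) := by
      have := congrArg Subtype.val (b.sum_repr ⟨y, hy⟩)
      rw [Submodule.coe_sum] at this
      exact this.symm
    rw [hy', sesq_sum, sesq_sum]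
    simp only [map_sum, Finset.mul_sum]
    conv_rhs => rw [Finset.sum_comm]
    refine Finset.sum_congr rfl fun i _ => ?_
    have hi := congrFun h i
    simp only [Pi.smul_apply, Matrix.mulVec, dotProduct, smul_eq_mul, Finset.mul_sum,
      Matrix.conjTranspose_apply, M, Matrix.of_apply] at hi
    have := congrArg (fun c => (starRingEnd ℂ) (b.repr ⟨y, hy⟩ i) * c) hi
    simp only [Finset.mul_sum] at this
    refine (Finset.sum_congr rfl fun j _ => ?_).trans
      (this.trans (Finset.sum_congr rfl fun j _ => ?_))
    · ring
    · simp only [map_mul, Complex.conj_conj, RCLike.star_def]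
      ring

lemma exists_reduction (a : V →ₗ⋆[ℂ] V →ₗ[ℂ] ℂ) (U : Submodule ℂ V) (k : ℕ)
    (hU : ∀ᶠ z : Circle in cofinite, HasNonnegSubspace a U (k + 1) z)
    (x : V) (hxU : x ∈ U) (hx0 : x ≠ 0) (hx : IsPencilVector a U x) (hxx : a x x = 0) :
    ∃ U' ≤ U, x ∉ U' ∧ (∀ y ∈ U', a y x = 0 ∧ a x y = 0) ∧
      ∀ᶠ z : Circle in cofinite, HasNonnegSubspace a U' k z := by
  obtain ⟨α, β, hαβ, hpen⟩ := hx
  obtain ⟨C, hC⟩ := Submodule.exists_isCompl (Submodule.span ℂ {x})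
  have hxC : x ∉ C := fun h => hx0 (by
    simpa using hC.disjoint.le_bot ⟨Submodule.mem_span_singleton_self x, h⟩)
  let W : Submodule ℂ V := U ⊓ (LinearMap.ker (a.flip x) ⊓ LinearMap.ker (a x))
  have hW : ∀ y, y ∈ W ↔ y ∈ U ∧ a y x = 0 ∧ a x y = 0 := fun y => by
    simp [W, LinearMap.flip_apply]
  refine ⟨C ⊓ W, inf_le_right.trans inf_le_left, fun h => hxC h.1,
    fun y hy => ((hW y).1 hy.2).2, ?_⟩
  filter_upwards [hU, eventually_circle_ne α β hαβ] with z ⟨N, hNU, hNk, hN⟩ hz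
  let φ : V →ₗ[ℂ] ℂ :=
    { toFun := fun y => z * a x y + (starRingEnd ℂ) (z * a y x)
      map_add' := fun y y' => by simp; ring
      map_smul' := fun c y => by simp; ring }
  have hφ : ∀ y, φ y = z * a x y + (starRingEnd ℂ) (z * a y x) := fun y => rfl
  have hφW : ∀ y ∈ U, φ y = 0 → y ∈ W := by
    intro y hy h
    rw [hφ, map_mul] at h
    have h1 := hpen y hy
    have h2 := congrArg (starRingEnd ℂ) h
    simp only [map_add, map_mul, Complex.conj_conj, map_zero] at h2
    have hp : a y x = 0 := by
      have : ((z : ℂ) * β + (starRingEnd ℂ) z * α) * a y x = 0 := by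
        linear_combination β * h2 + (starRingEnd ℂ) z * h1
      exact (mul_eq_zero.1 this).resolve_left hz
    have hq : (starRingEnd ℂ) (a x y) = 0 := by
      have : ((z : ℂ) * β + (starRingEnd ℂ) z * α) * (starRingEnd ℂ) (a x y) = 0 := by
        linear_combination α * h2 - (z : ℂ) * h1
      exact (mul_eq_zero.1 this).resolve_left hz
    exact (hW y).2 ⟨hy, hp, by simpa using hq⟩
  have hxW : x ∈ W := (hW x).2 ⟨hxU, hxx, hxx⟩
  have hexp : ∀ (y : V) (c : ℂ), ((z : ℂ) * a (y + c • x) (y + c • x)).re =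
      ((z : ℂ) * a y y).re + ((starRingEnd ℂ) c * φ y).re := by
    intro y c
    have : (z : ℂ) * a (y + c • x) (y + c • x) = z * a y y + (starRingEnd ℂ) c * (z * a x y) +
        c * (z * a y x) := by
      simp [hxx]; ring
    rw [this, hφ, mul_add, Complex.add_re, Complex.add_re, Complex.add_re, ← map_mul,
      Complex.conj_re]
    ring
  have hcs : x ∈ N → ∀ y ∈ N, φ y = 0 := by
    intro hxN y hy
    by_contra hne
    set H := ((z : ℂ) * a y y).re with hH
    have hH0 : 0 ≤ H := hN y hy
    have hpos : 0 < Complex.normSq (φ y) := Complex.normSq_pos.2 hne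
    have h := hN (y + (((-((H + 1) / Complex.normSq (φ y)) : ℝ) : ℂ) * φ y) • x)
      (N.add_mem hy (N.smul_mem _ hxN))
    rw [hexp, map_mul, Complex.conj_ofReal, mul_assoc, ← Complex.normSq_eq_conj_mul_self,
      ← Complex.ofReal_mul, Complex.ofReal_re, neg_mul, div_mul_cancel₀ _ hpos.ne'] at h
    linarith
  let M : Submodule ℂ V := (N ⊓ W) ⊔ Submodule.span ℂ {x}
  have hMdim : k + 1 ≤ Module.finrank ℂ M := by
    by_cases hxN : x ∈ N
    · refine hNk.trans (Submodule.finrank_mono ?_)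
      exact (le_inf le_rfl fun y hy => hφW y (hNU hy) (hcs hxN y hy)).trans le_sup_left
    · have h1 := Submodule.finrank_sup_add_finrank_inf_eq (N ⊓ W) (Submodule.span ℂ {x})
      have h2 : (N ⊓ W) ⊓ Submodule.span ℂ {x} = ⊥ := by
        rw [← disjoint_iff, Submodule.disjoint_span_singleton' hx0]
        exact fun h => hxN h.1
      rw [h2, finrank_bot, finrank_span_singleton hx0] at h1
      have h3 := Submodule.finrank_sup_add_finrank_inf_eq N (LinearMap.ker φ)
      have h4 : Module.finrank ℂ ↥(N ⊓ LinearMap.ker φ) ≤ Module.finrank ℂ ↥(N ⊓ W) :=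
        Submodule.finrank_mono (le_inf inf_le_left fun y hy => hφW y (hNU hy.1) hy.2)
      have h5 := LinearMap.finrank_range_add_finrank_ker φ
      have h6 := Submodule.finrank_le (LinearMap.range φ)
      have h7 := Submodule.finrank_le (N ⊔ LinearMap.ker φ)
      rw [Module.finrank_self] at h6
      change k + 1 ≤ Module.finrank ℂ ↥((N ⊓ W) ⊔ Submodule.span ℂ {x})
      omega
  refine ⟨M ⊓ C, le_inf inf_le_right (inf_le_left.trans (sup_le inf_le_right ?_)), ?_, ?_⟩
  · rwa [Submodule.span_singleton_le_iff_mem]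
  · have h1 := Submodule.finrank_sup_add_finrank_inf_eq M C
    have h2 := Submodule.finrank_le (M ⊔ C)
    have h3 := Submodule.finrank_add_eq_of_isCompl hC
    rw [finrank_span_singleton hx0] at h3
    omega
  · rintro w ⟨hw, -⟩
    obtain ⟨y, hy, y', hy', rfl⟩ := Submodule.mem_sup.1 hw
    obtain ⟨c, rfl⟩ := Submodule.mem_span_singleton.1 hy'
    obtain ⟨-, h1, h2⟩ := (hW y).1 hy.2
    rw [hexp, hφ, h1, h2]
    simpa using hN y hy.1

lemma exists_diagonal (a : V →ₗ⋆[ℂ] V →ₗ[ℂ] ℂ) (n : ℕ) : ∀ U : Submodule ℂ V,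
    Module.finrank ℂ U = n → (∀ x ∈ U, x ≠ 0 → IsPencilVector a U x → a x x ≠ 0) →
    ∃ (v : Fin n → V) (d : Fin n → ℂ), LinearIndependent ℂ v ∧
      Submodule.span ℂ (Set.range v) = U ∧ (∀ i j, a (v i) (v j) = if i = j then d i else 0) ∧
      ∀ i, d i ≠ 0 := by
  induction n with
  | zero =>
    intro U hU _
    refine ⟨Fin.elim0, Fin.elim0, linearIndependent_empty_type, ?_, fun i => i.elim0,
      fun i => i.elim0⟩
    rw [Submodule.finrank_eq_zero.1 hU]
    simp
  | succ n ih =>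
    intro U hU hno
    have hUne : U ≠ ⊥ := fun h => by rw [h, finrank_bot] at hU; omega
    obtain ⟨x, hxU, hx0, hpen⟩ := exists_pencilVector a U hUne
    have hxx := hno x hxU hx0 hpen
    obtain ⟨α, β, hαβ, hpen⟩ := hpen
    have hα : α ≠ 0 := by
      rintro rfl
      have h := hpen x hxU
      simp [hxx] at h
      simp [h] at hαβ
    let U' : Submodule ℂ V := U ⊓ LinearMap.ker (a x)
    have hU'1 : ∀ y ∈ U', a x y = 0 := fun y hy => hy.2
    have hU'2 : ∀ y ∈ U', a y x = 0 := fun y hy => by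
      have h := hpen y hy.1
      rw [hU'1 y hy, map_zero, mul_zero] at h
      exact (mul_eq_zero.1 h).resolve_left hα
    have hxU' : x ∉ U' := fun h => hxx (hU'1 x h)
    have hdec : ∀ y ∈ U, ∃ (c : ℂ), ∃ y' ∈ U', y = c • x + y' := fun y hy =>
      ⟨a x y / a x x, y - (a x y / a x x) • x,
        ⟨U.sub_mem hy (U.smul_mem _ hxU), by simp [hxx]⟩, by abel⟩
    have hsup : U' ⊔ Submodule.span ℂ {x} = U := by
      refine le_antisymm (sup_le inf_le_left ?_) fun y hy => ?_
      · rwa [Submodule.span_singleton_le_iff_mem]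
      · obtain ⟨c, y', hy', rfl⟩ := hdec y hy
        exact add_mem (Submodule.mem_sup_right (Submodule.smul_mem _ _
          (Submodule.mem_span_singleton_self x))) (Submodule.mem_sup_left hy')
    have hdim : Module.finrank ℂ U' = n := by
      have h1 := Submodule.finrank_sup_add_finrank_inf_eq U' (Submodule.span ℂ {x})
      have h2 : U' ⊓ Submodule.span ℂ {x} = ⊥ := by
        rw [← disjoint_iff, Submodule.disjoint_span_singleton' hx0]
        exact hxU'
      rw [hsup, h2, finrank_bot, finrank_span_singleton hx0, hU] at h1
      omega
    obtain ⟨v, d, hv1, hv2, hv3, hv4⟩ := ih U' hdim (by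
      rintro x' hx' hx'0 ⟨α', β', hαβ', hpen'⟩
      refine hno x' hx'.1 hx'0 ⟨α', β', hαβ', fun y hy => ?_⟩
      obtain ⟨c, y', hy', rfl⟩ := hdec y hy
      simpa [hU'1 x' hx', hU'2 x' hx'] using hpen' y' hy')
    have hvU' : ∀ i, v i ∈ U' := fun i => hv2 ▸ Submodule.subset_span (Set.mem_range_self i)
    refine ⟨Fin.cons x v, Fin.cons (a x x) d, ?_, ?_, ?_, ?_⟩
    · rw [linearIndependent_finCons, hv2]
      exact ⟨hv1, hxU'⟩
    · rw [Fin.range_cons, Submodule.span_insert, hv2, sup_comm, hsup]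
    · intro i j
      refine Fin.cases ?_ (fun i => ?_) i <;> refine Fin.cases ?_ (fun j => ?_) j
      · simp
      · simp [hU'1 _ (hvU' j), (Fin.succ_ne_zero j).symm]
      · simpa using hU'2 _ (hvU' i)
      · simp [hv3]
    · intro i
      refine Fin.cases ?_ (fun i => ?_) i
      · simpa using hxx
      · simpa using hv4 i

lemma exists_isotropic (a : V →ₗ⋆[ℂ] V →ₗ[ℂ] ℂ) (m : ℕ) : ∀ (U : Submodule ℂ V) (k : ℕ),
    Module.finrank ℂ U = m → (∀ᶠ z : Circle in cofinite, HasNonnegSubspace a U k z) →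
    ∃ S ≤ U, Module.finrank ℂ S = k ∧ ∀ x ∈ S, ∀ y ∈ S, a x y = 0 := by
  induction m using Nat.strong_induction_on with
  | _ m ih =>
  intro U k hUm hk
  rcases k with _ | k
  · exact ⟨⊥, bot_le, finrank_bot ℂ V, by simp⟩
  by_cases hcase : ∃ x ∈ U, x ≠ 0 ∧ IsPencilVector a U x ∧ a x x = 0
  · obtain ⟨x, hxU, hx0, hpen, hxx⟩ := hcase
    obtain ⟨U', hU', hxU', horth, hk'⟩ := exists_reduction a U k hk x hxU hx0 hpen hxx
    obtain ⟨S, hSU, hS, hiso⟩ := ih _ (hUm ▸ Submodule.finrank_lt_finrank_of_lt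
      (lt_of_le_of_ne hU' fun h => hxU' (h ▸ hxU))) U' k rfl hk'
    refine ⟨S ⊔ Submodule.span ℂ {x}, sup_le (hSU.trans hU') ?_, ?_, ?_⟩
    · rwa [Submodule.span_singleton_le_iff_mem]
    · have h1 := Submodule.finrank_sup_add_finrank_inf_eq S (Submodule.span ℂ {x})
      have h2 : S ⊓ Submodule.span ℂ {x} = ⊥ := by
        rw [← disjoint_iff, Submodule.disjoint_span_singleton' hx0]
        exact fun h => hxU' (hSU h)
      rw [h2, finrank_bot, finrank_span_singleton hx0] at h1
      omega
    · intro u hu w hw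
      obtain ⟨s, hs, s', hs', rfl⟩ := Submodule.mem_sup.1 hu
      obtain ⟨t, ht, t', ht', rfl⟩ := Submodule.mem_sup.1 hw
      obtain ⟨c, rfl⟩ := Submodule.mem_span_singleton.1 hs'
      obtain ⟨c', rfl⟩ := Submodule.mem_span_singleton.1 ht'
      simp [hiso s hs t ht, (horth s (hSU hs)).1, (horth t (hSU ht)).2, hxx]
  · have hno : ∀ x ∈ U, x ≠ 0 → IsPencilVector a U x → a x x ≠ 0 := fun x h1 h2 h3 h4 =>
      hcase ⟨x, h1, h2, h3, h4⟩
    obtain ⟨v, d, hv, hspan, hav, hd⟩ := exists_diagonal a m U hUm hno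
    have : Infinite Circle := Infinite.of_injective _ circleDir_injective
    have : Nonempty (Fin m) := by
      obtain ⟨z, N, hNU, hN, -⟩ := hk.exists
      have := Submodule.finrank_mono hNU
      rw [hUm] at this
      exact Fin.pos_iff_nonempty.1 (by omega)
    have hvU : ∀ i, v i ∈ U := fun i => hspan ▸ Submodule.subset_span (Set.mem_range_self i)
    let e : (Fin m → ℂ) →ₗ[ℂ] V := Fintype.linearCombination ℂ v
    have he : ∀ w, e w = ∑ i, w i • v i := fun w => Fintype.linearCombination_apply ℂ v w
    have he_inj : Function.Injective e := hv.fintypeLinearCombination_injective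
    have he_range : LinearMap.range e = U := by
      rw [← hspan]; exact Fintype.range_linearCombination ℂ v
    have hform : ∀ w w', a (e w) (e w') = ∑ i, (starRingEnd ℂ) (w i) * (w' i * d i) := by
      intro w w'
      rw [he, he, sesq_sum]
      simp [hav]
    have hquad : ∀ (z : ℂ) w, (z * a (e w) (e w)).re = ∑ i, (z * d i).re * ‖w i‖ ^ 2 := by
      intro z w
      rw [hform, Finset.mul_sum, Complex.re_sum]
      refine Finset.sum_congr rfl fun i _ => ?_
      have : z * ((starRingEnd ℂ) (w i) * (w i * d i)) = ((‖w i‖ ^ 2 : ℝ) : ℂ) * (z * d i) := by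
        rw [← Complex.normSq_eq_norm_sq, Complex.normSq_eq_conj_mul_self]; ring
      rw [this, Complex.re_ofReal_mul, mul_comm]
    have hpar : ∀ i j (ρ : ℝ), d i = ρ * d j → 0 < ρ := by
      intro i j ρ hρ
      by_contra hneg
      have hρ0 : ρ ≠ 0 := by
        rintro rfl
        exact hd i (by simpa using hρ)
      have hρneg : ρ < 0 := lt_of_le_of_ne (not_lt.1 hneg) hρ0
      have hij : i ≠ j := by
        rintro rfl
        have : (ρ : ℂ) = 1 := mul_right_cancel₀ (hd i) (by rw [← hρ, one_mul])
        have : ρ = 1 := by exact_mod_cast this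
        linarith
      have hsq : ((√(-ρ) : ℝ) : ℂ) * (√(-ρ) : ℝ) = -ρ := by
        rw [← Complex.ofReal_mul, Real.mul_self_sqrt (by linarith)]; simp
      set w : Fin m → ℂ := Pi.single i 1 + Pi.single j ((√(-ρ) : ℝ) : ℂ) with hw
      have hwi : w i = 1 := by simp [hw, hij]
      have hwj : w j = (√(-ρ) : ℝ) := by simp [hw, hij.symm]
      have hwo : ∀ l, l ≠ i → l ≠ j → w l = 0 := fun l h1 h2 => by simp [hw, h1, h2]
      refine hno (e w) (he_range ▸ LinearMap.mem_range_self e w) ?_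
        ⟨(starRingEnd ℂ) (d j), d j, Or.inr (hd j), ?_⟩ ?_
      · intro h
        have := he_inj (h.trans (map_zero e).symm)
        rw [this] at hwi
        simp at hwi
      · intro y hy
        rw [← he_range] at hy
        obtain ⟨y, rfl⟩ := hy
        rw [hform, hform, map_sum, Finset.mul_sum, Finset.mul_sum]
        refine Finset.sum_congr rfl fun l _ => ?_
        by_cases h1 : l = i
        · subst h1
          rw [hwi, hρ]; simp; ring
        by_cases h2 : l = j
        · subst h2
          rw [hwj]; simp; ring
        · simp [hwo l h1 h2]
      · rw [hform, Finset.sum_eq_add i j hij (fun l _ h => by simp [hwo l h.1 h.2])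
          (by simp) (by simp), hwi, hwj, hρ, Complex.conj_ofReal, map_one]
        linear_combination d j * hsq
    have hcard : ∀ᶠ z : Circle in cofinite,
        k + 1 ≤ (Finset.univ.filter fun i => 0 < ((z : ℂ) * d i).re).card := by
      have hgen : ∀ᶠ z : Circle in cofinite, ∀ i, ((z : ℂ) * d i).re ≠ 0 := by
        rw [Filter.eventually_all]
        intro i
        filter_upwards [eventually_circle_ne ((starRingEnd ℂ) (d i)) (d i) (Or.inr (hd i))]
          with z hz h
        apply hz
        rw [← map_mul, Complex.add_conj, h]
        simp
      filter_upwards [hk, hgen] with z ⟨N, hNU, hNk, hN⟩ hz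
      refine le_trans ?_ (finrank_le_card_pos _ hz (N.comap e) fun w hw => ?_)
      · rwa [(Submodule.equivMapOfInjective e he_inj _).finrank_eq,
          Submodule.map_comap_eq_self (hNU.trans he_range.ge)]
      · rw [← hquad]
        exact hN _ hw
    obtain ⟨y, ⟨i, hyi⟩, hy⟩ := exists_hyperplane_of_diagonal d hd hpar (k + 1) hcard
    let ℓ : (Fin m → ℂ) →ₗ[ℂ] ℂ := Fintype.linearCombination ℂ fun i => (y i : ℂ)
    have hℓ : ∀ w, ℓ w = ∑ i, (y i : ℂ) * w i := fun w => by
      simp [ℓ, Fintype.linearCombination_apply, mul_comm]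
    have hU'U : (LinearMap.ker ℓ).map e ≤ U := by
      rw [← he_range]; exact LinearMap.map_le_range
    have hlt : (LinearMap.ker ℓ).map e < U := by
      refine lt_of_le_of_ne hU'U fun h => ?_
      have h1 : v i ∈ (LinearMap.ker ℓ).map e := h ▸ hvU i
      obtain ⟨w, hw, hwv⟩ := h1
      have : w = Pi.single i 1 := he_inj (by rw [hwv, he]; simp [Pi.single_apply])
      rw [SetLike.mem_coe, LinearMap.mem_ker, hℓ, this] at hw
      simp [Pi.single_apply, hyi] at hw
    have hk' : ∀ᶠ z : Circle in cofinite,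
        HasNonnegSubspace a ((LinearMap.ker ℓ).map e) (k + 1) z := by
      filter_upwards [hy] with z ⟨N, hNk, hN⟩
      refine ⟨N.map e, Submodule.map_mono fun w hw => ?_, ?_, ?_⟩
      · rw [LinearMap.mem_ker, hℓ]
        exact (hN w hw).1
      · rwa [← (Submodule.equivMapOfInjective e he_inj N).finrank_eq]
      · rintro _ ⟨w, hw, rfl⟩
        rw [hquad]
        exact (hN w hw).2
    obtain ⟨S, hSU, hS⟩ :=
      ih _ ((Submodule.finrank_lt_finrank_of_lt hlt).trans_eq hUm) _ (k + 1) rfl hk'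
    exact ⟨S, hSU.trans hU'U, hS⟩

end Sesquilinear

section Matrices

variable {n : ℕ}

lemma le_card_of_le_lambdaKth {H : Matrix (Fin n) (Fin n) ℂ} (hH : H.IsHermitian) {k : ℕ}
    (hk1 : 1 ≤ k) (hkn : k ≤ n) {c : ℝ} (hc : c ≤ lambdaKth H k) :
    k ≤ (Finset.univ.filter fun i => c ≤ hH.eigenvalues i).card := by
  rw [lambdaKth, dif_pos hH] at hc
  set L := (Finset.univ.val.map hH.eigenvalues).sort (· ≤ ·) with hL
  have hLm : (L : Multiset ℝ) = Finset.univ.val.map hH.eigenvalues := Multiset.sort_eq _ _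
  have hlen : L.length = n := by simp [hL]
  have hsort : L.Pairwise (· ≤ ·) := Multiset.pairwise_sort _ _
  have hlt : n - k < L.length := by omega
  rw [List.getD_eq_getElem _ _ hlt] at hc
  have hdrop : ∀ x ∈ L.drop (n - k), c ≤ x := by
    intro x hx
    have hd := hsort.sublist (List.drop_sublist (n - k) L)
    rw [List.drop_eq_getElem_cons hlt] at hx hd
    rcases List.mem_cons.1 hx with rfl | hx
    · exact hc
    · exact hc.trans ((List.pairwise_cons.1 hd).1 x hx)
  have hcount : k ≤ L.countP (fun x => decide (c ≤ x)) := by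
    refine le_trans ?_ (List.Sublist.countP_le (List.drop_sublist (n - k) L))
    rw [List.countP_eq_length.2 (by simpa using hdrop), List.length_drop, hlen]
    omega
  have : L.countP (fun x => decide (c ≤ x)) =
      (Finset.univ.filter fun i => c ≤ hH.eigenvalues i).card := by
    rw [← Multiset.coe_countP, hLm, Multiset.countP_map]
    rfl
  omega

/-- The sesquilinear form `(x, y) ↦ x* B y` on Euclidean space. -/
noncomputable def matrixForm (B : Matrix (Fin n) (Fin n) ℂ) :
    EuclideanSpace ℂ (Fin n) →ₗ⋆[ℂ] EuclideanSpace ℂ (Fin n) →ₗ[ℂ] ℂ :=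
  LinearMap.mk₂'ₛₗ (starRingEnd ℂ) (RingHom.id ℂ)
    (fun x y => star x.ofLp ⬝ᵥ (B *ᵥ y.ofLp))
    (fun x y z => by simp [add_dotProduct]) (fun c x y => by simp)
    (fun x y z => by simp [mulVec_add, dotProduct_add])
    (fun c x y => by simp [mulVec_smul])

lemma matrixForm_apply (B : Matrix (Fin n) (Fin n) ℂ) (x y : EuclideanSpace ℂ (Fin n)) :
    matrixForm B x y = star x.ofLp ⬝ᵥ (B *ᵥ y.ofLp) := rfl

lemma matrixForm_one (x y : EuclideanSpace ℂ (Fin n)) : matrixForm 1 x y = inner ℂ x y := by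
  rw [matrixForm_apply, one_mulVec, EuclideanSpace.inner_eq_star_dotProduct, dotProduct_comm]

lemma matrixForm_conjTranspose (B : Matrix (Fin n) (Fin n) ℂ) (x y : EuclideanSpace ℂ (Fin n)) :
    matrixForm Bᴴ x y = (starRingEnd ℂ) (matrixForm B y x) := by
  rw [matrixForm_apply, matrixForm_apply, starRingEnd_apply, ← star_dotProduct_star,
    star_star, star_mulVec, ← dotProduct_mulVec]

lemma matrixForm_add (B C : Matrix (Fin n) (Fin n) ℂ) (x y : EuclideanSpace ℂ (Fin n)) :
    matrixForm (B + C) x y = matrixForm B x y + matrixForm C x y := by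
  simp [matrixForm_apply, add_mulVec, dotProduct_add]

lemma matrixForm_smul (c : ℂ) (B : Matrix (Fin n) (Fin n) ℂ) (x y : EuclideanSpace ℂ (Fin n)) :
    matrixForm (c • B) x y = c * matrixForm B x y := by
  simp [matrixForm_apply, smul_mulVec, dotProduct_smul]

/-- If at least `k` eigenvalues of `H` are at least `c`, the form of `H - c` is nonnegative on a
subspace of dimension at least `k`. -/
lemma exists_subspace_of_eigenvalues {H : Matrix (Fin n) (Fin n) ℂ} (hH : H.IsHermitian) {k : ℕ}
    {c : ℝ} (hk : k ≤ (Finset.univ.filter fun i => c ≤ hH.eigenvalues i).card) :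
    ∃ N : Submodule ℂ (EuclideanSpace ℂ (Fin n)), k ≤ Module.finrank ℂ N ∧
      ∀ w ∈ N, c * ‖w‖ ^ 2 ≤ (matrixForm H w w).re := by
  classical
  let s := Finset.univ.filter fun i => c ≤ hH.eigenvalues i
  let b := hH.eigenvectorBasis
  have hb : LinearIndependent ℂ b := b.orthonormal.linearIndependent
  refine ⟨Submodule.span ℂ (Set.range fun i : s => b i), ?_, ?_⟩
  · exact hk.trans_eq ((Fintype.card_coe s).symm.trans
      (finrank_span_eq_card (hb.comp _ Subtype.val_injective)).symm)
  · intro w hw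
    have hrepr : ∀ i, i ∉ s → inner ℂ (b i) w = 0 := by
      intro i hi
      induction hw using Submodule.span_induction with
      | mem x hx =>
        obtain ⟨j, rfl⟩ := hx
        exact b.orthonormal.2 fun h => hi (h ▸ j.2)
      | zero => simp
      | add x y _ _ hx hy => rw [inner_add_right, hx, hy, add_zero]
      | smul c x _ hx => rw [inner_smul_right, hx, mul_zero]
    have hform : (matrixForm H w w).re = ∑ i, hH.eigenvalues i * ‖inner ℂ (b i) w‖ ^ 2 := by
      have h1 : matrixForm H w w = matrixForm H (∑ i, inner ℂ (b i) w • b i)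
          (∑ i, inner ℂ (b i) w • b i) := by rw [b.sum_repr' w]
      have h2 : ∀ i j, matrixForm H (b i) (b j) =
          if i = j then (hH.eigenvalues j : ℂ) else 0 := by
        intro i j
        have : matrixForm H (b i) (b j) = hH.eigenvalues j * matrixForm 1 (b i) (b j) := by
          rw [matrixForm_apply, hH.mulVec_eigenvectorBasis, matrixForm_apply, one_mulVec,
            dotProduct_smul, Complex.real_smul]
        rw [this, matrixForm_one, orthonormal_iff_ite.1 b.orthonormal]
        split_ifs <;> simp
      rw [h1, sesq_sum, Complex.re_sum]
      refine Finset.sum_congr rfl fun i _ => ?_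
      simp only [h2, mul_ite, mul_zero, Finset.sum_ite_eq, Finset.mem_univ, if_true]
      rw [← mul_assoc, ← Complex.normSq_eq_conj_mul_self, ← Complex.ofReal_mul,
        Complex.ofReal_re, Complex.normSq_eq_norm_sq, mul_comm]
    rw [hform, ← b.sum_sq_norm_inner_right w, Finset.mul_sum]
    refine Finset.sum_le_sum fun i _ => ?_
    by_cases hi : i ∈ s
    · exact mul_le_mul_of_nonneg_right (Finset.mem_filter.1 hi).2 (by positivity)
    · simp [hrepr i hi]

open ComplexOrder in
/-- The orthogonal projection onto a subspace that is isotropic for `A - μ` witnesses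
`μ ∈ rankKRange k A`. -/
lemma mem_rankKRange_of_isotropic {A : Matrix (Fin n) (Fin n) ℂ} {μ : ℂ} {k : ℕ}
    (S : Submodule ℂ (EuclideanSpace ℂ (Fin n))) (hS : Module.finrank ℂ S = k)
    (hiso : ∀ x ∈ S, ∀ y ∈ S, matrixForm (A - μ • 1) x y = 0) : μ ∈ rankKRange k A := by
  let b := (stdOrthonormalBasis ℂ S).reindex (finCongr hS)
  let Q : Matrix (Fin n) (Fin k) ℂ := Matrix.of fun i j => (b j : EuclideanSpace ℂ (Fin n)) i
  have hQ : ∀ B : Matrix (Fin n) (Fin n) ℂ, ∀ i j,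
      (Qᴴ * B * Q) i j = matrixForm B (b i) (b j) := by
    intro B i j
    rw [Matrix.mul_assoc]
    rfl
  have hQ1 : Qᴴ * Q = 1 := by
    ext i j
    have := hQ 1 i j
    rw [Matrix.mul_one] at this
    rw [this, matrixForm_one, Matrix.one_apply, ← Submodule.coe_inner,
      orthonormal_iff_ite.1 b.orthonormal]
  have hQA : Qᴴ * A * Q = μ • 1 := by
    have h0 : Qᴴ * (A - μ • 1) * Q = 0 := by
      ext i j
      rw [hQ]
      exact hiso _ (b i).2 _ (b j).2
    rw [Matrix.mul_sub, Matrix.sub_mul, sub_eq_zero] at h0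
    rw [h0]
    simp [hQ1]
  refine ⟨Q * Qᴴ, Matrix.isHermitian_mul_conjTranspose_self Q, ?_, ?_, ?_⟩
  · rw [Matrix.mul_assoc, ← Matrix.mul_assoc Qᴴ, hQ1, Matrix.one_mul]
  · rw [Matrix.rank_self_mul_conjTranspose, ← Matrix.rank_conjTranspose_mul_self, hQ1,
      Matrix.rank_one, Fintype.card_fin]
  · calc Q * Qᴴ * A * (Q * Qᴴ) = Q * (Qᴴ * A * Q) * Qᴴ := by simp only [Matrix.mul_assoc]
      _ = μ • (Q * Qᴴ) := by rw [hQA]; simp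

end Matrices

/-- `Ω_k(A) ⊆ Λ_k(A)`. -/
theorem Omega_subset_rankKRange {n k : ℕ} (hk1 : 1 ≤ k) (hkn : k ≤ n)
    (A : Matrix (Fin n) (Fin n) ℂ) (μ : ℂ)
    (hμ : ∀ ξ ∈ Set.Ico (0 : ℝ) (2 * Real.pi),
      (Complex.exp (ξ * Complex.I) * μ
          + Complex.exp (-(ξ * Complex.I)) * (starRingEnd ℂ) μ).re
        ≤ lambdaKth (Complex.exp (ξ * Complex.I) • A
          + Complex.exp (-(ξ * Complex.I)) • Aᴴ) k) :
    μ ∈ rankKRange k A := by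
  have key : ∀ z : Circle, HasNonnegSubspace (matrixForm (A - μ • 1)) ⊤ k z := by
    intro z
    obtain ⟨ξ, hξ, hz⟩ : ∃ ξ ∈ Set.Ico (0 : ℝ) (2 * Real.pi),
        Complex.exp (ξ * Complex.I) = z := by
      refine ⟨toIcoMod Real.two_pi_pos 0 (Complex.arg z), by
        simpa using toIcoMod_mem_Ico Real.two_pi_pos 0 (Complex.arg z), ?_⟩
      rw [← Circle.coe_exp, toIcoMod, Circle.periodic_exp.sub_zsmul_eq, Circle.exp_arg]
    have hz' : Complex.exp (-(ξ * Complex.I)) = (starRingEnd ℂ) (z : ℂ) := by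
      rw [← hz, ← Complex.exp_conj]
      simp
    have h := hμ ξ hξ
    rw [hz', hz] at h
    have hH : ((z : ℂ) • A + (starRingEnd ℂ) (z : ℂ) • Aᴴ).IsHermitian := by
      rw [Matrix.IsHermitian, Matrix.conjTranspose_add, Matrix.conjTranspose_smul,
        Matrix.conjTranspose_smul, Matrix.conjTranspose_conjTranspose, add_comm]
      simp
    obtain ⟨N, hNk, hN⟩ := exists_subspace_of_eigenvalues hH
      (le_card_of_le_lambdaKth hH hk1 hkn h)
    refine ⟨N, le_top, hNk, fun w hw => ?_⟩
    have h1 := hN w hw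
    rw [matrixForm_add, matrixForm_smul, matrixForm_smul, matrixForm_conjTranspose, ← map_mul,
      ← map_mul, Complex.add_re, Complex.add_re, Complex.conj_re, Complex.conj_re] at h1
    rw [sub_eq_add_neg, ← neg_smul, matrixForm_add, matrixForm_smul, matrixForm_one,
      inner_self_eq_norm_sq_to_K]
    have h2 : ((z : ℂ) * (matrixForm A w w + -μ * ((‖w‖ : ℝ) : ℂ) ^ 2)).re =
        ((z : ℂ) * matrixForm A w w).re - ((z : ℂ) * μ).re * ‖w‖ ^ 2 := by
      rw [show (z : ℂ) * (matrixForm A w w + -μ * ((‖w‖ : ℝ) : ℂ) ^ 2) =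
        z * matrixForm A w w - z * μ * ((‖w‖ ^ 2 : ℝ) : ℂ) by push_cast; ring,
        Complex.sub_re, Complex.re_mul_ofReal]
    refine le_of_le_of_eq ?_ h2.symm
    linarith
  obtain ⟨S, -, hS, hiso⟩ := exists_isotropic (matrixForm (A - μ • 1)) _ ⊤ k rfl
    (Filter.Eventually.of_forall key)
  exact mem_rankKRange_of_isotropic S hS hiso
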